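/- Let d be an admissible sequence and a an admissible family. Then for every real s > 0 the series G(s) = Σ_{m≥0} Σ_{n∈ℤ} c^{2n+m} q^{n-m/2} d_m a(n,m) · Σ_{l ≥ max(l₁, -n)} (cα)^l q^{l/2} (q^{s(2n+m+2l)} - q^{s(|n+m|+|n|)}) converges absolutely, and lim_{s→0⁺} s·G(s) = 0. -/

import Mathlib

open Filter Topology

noncomputable section

/-- `qc q x` is the real power `q ^ x`, viewed as a complex number. -/
def qc (q : ℝ) (x : ℝ) : ℂ := ((q ^ x : ℝ) : ℂ)

/-- An admissible sequence: `d m = q^(m/2) (c₁ c^m + c₂ c^(-m))` for all `m ≥ l₁`. -/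
def IsAdmissibleSeq (q : ℝ) (c : ℂ) (l₁ : ℤ) (d : ℕ → ℂ) : Prop :=
  ∃ c₁ c₂ : ℂ, ∀ m : ℕ, l₁ ≤ (m : ℤ) →
    d m = qc q ((m : ℝ) / 2) * (c₁ * c ^ (m : ℤ) + c₂ * c ^ (-(m : ℤ)))

/-- An admissible family on `ℤ × ℕ`, given by region asymptotics. -/
def IsAdmissibleFam (q : ℝ) (l₁ : ℤ) (a : ℤ → ℕ → ℂ) : Prop :=
  ∃ (k₁ k₂ k₃ : ℂ) (A B : ℤ → ℂ), ∀ (n : ℤ) (m : ℕ),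
    (l₁ ≤ n → a n m = k₁) ∧
    (-l₁ < n → n < l₁ → l₁ ≤ n + (m : ℤ) → a n m = A n) ∧
    (n ≤ -l₁ → l₁ ≤ n + (m : ℤ) → a n m = qc q (-(n : ℝ)) * k₂) ∧
    (n ≤ -l₁ → -l₁ < n + (m : ℤ) → n + (m : ℤ) < l₁ →
      a n m = qc q (-(n : ℝ)) * B (n + m)) ∧
    (n + (m : ℤ) ≤ -l₁ → a n m = qc q (-(2 * (n : ℝ) + (m : ℝ))) * k₃)

/-- An `l`-stabilized family on `ℤ × ℕ` (the regions do not depend on `l`). -/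
def IsStabilizedFam (q : ℝ) (c : ℂ) (l₁ : ℤ) (e : ℤ → ℕ → ℂ) : Prop :=
  ∃ (u w : ℂ) (f v : ℤ → ℂ) (N : ℤ), 2 * l₁ < N ∧ ∀ (n : ℤ) (m : ℕ),
    (l₁ ≤ n → e n m = (c ^ 2 * (q : ℂ)) ^ n * (c * qc q (1 / 2)) ^ m * u) ∧
    (-l₁ < n → n < l₁ → N ≤ (m : ℤ) → e n m = (c * qc q (1 / 2)) ^ m * f n) ∧
    (n ≤ -l₁ → -l₁ < n + (m : ℤ) → n + (m : ℤ) < l₁ → N ≤ (m : ℤ) →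
      e n m = qc q ((m : ℝ) / 2) * c ^ (-(m : ℤ)) * v (n + m)) ∧
    (n + (m : ℤ) ≤ -l₁ → e n m = (c ^ 2 * (q : ℂ)⁻¹) ^ n * (c * qc q (-(1 / 2))) ^ m * w)

/-- On a finite set, a nonnegative function is bounded by a multiple of any positive weight. -/
lemma exists_forall_mem_le_mul {ι : Type*} (S : Finset ι) (f w : ι → ℝ)
    (hf : ∀ i, 0 ≤ f i) (hw : ∀ i, 0 < w i) :
    ∃ K : ℝ, 0 ≤ K ∧ ∀ i ∈ S, f i ≤ K * w i := by
  refine ⟨∑ i ∈ S, f i / w i, Finset.sum_nonneg fun i _ => div_nonneg (hf i) (hw i).le, ?_⟩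
  intro i hi
  rw [← div_le_iff₀ (hw i)]
  exact Finset.single_le_sum (f := fun i => f i / w i)
    (fun i _ => div_nonneg (hf i) (hw i).le) hi

lemma norm_qc {q : ℝ} (hq : 0 < q) (x : ℝ) : ‖qc q x‖ = q ^ x := by
  rw [qc, Complex.norm_real, Real.norm_of_nonneg (Real.rpow_pos_of_pos hq x).le]

lemma IsAdmissibleSeq.exists_norm_le {q : ℝ} (hq : 0 < q) {c : ℂ} (hc : ‖c‖ = 1) {l₁ : ℤ}
    {d : ℕ → ℂ} (hd : IsAdmissibleSeq q c l₁ d) :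
    ∃ D : ℝ, 0 ≤ D ∧ ∀ m : ℕ, ‖d m‖ ≤ D * q ^ ((m : ℝ) / 2) := by
  obtain ⟨c₁, c₂, h⟩ := hd
  obtain ⟨K, hK, hKm⟩ := exists_forall_mem_le_mul (Finset.range l₁.toNat) (fun m => ‖d m‖)
    (fun m => q ^ ((m : ℝ) / 2)) (fun _ => norm_nonneg _) (fun _ => Real.rpow_pos_of_pos hq _)
  refine ⟨K + (‖c₁‖ + ‖c₂‖), by positivity, fun m => ?_⟩
  have hpos : 0 < q ^ ((m : ℝ) / 2) := Real.rpow_pos_of_pos hq _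
  rcases lt_or_ge (m : ℤ) l₁ with hm | hm
  · refine (hKm m (Finset.mem_range.2 (by omega))).trans ?_
    gcongr
    exact le_add_of_nonneg_right (by positivity)
  · rw [h m hm, norm_mul, norm_qc hq, mul_comm]
    gcongr
    calc ‖c₁ * c ^ (m : ℤ) + c₂ * c ^ (-(m : ℤ))‖
        ≤ ‖c₁ * c ^ (m : ℤ)‖ + ‖c₂ * c ^ (-(m : ℤ))‖ := norm_add_le _ _
      _ = ‖c₁‖ + ‖c₂‖ := by simp [hc]
      _ ≤ K + (‖c₁‖ + ‖c₂‖) := le_add_of_nonneg_left hK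

lemma IsAdmissibleFam.exists_norm_le {q : ℝ} (hq0 : 0 < q) (hq1 : q < 1) {l₁ : ℤ}
    (hl₁ : 0 < l₁) {a : ℤ → ℕ → ℂ} (ha : IsAdmissibleFam q l₁ a) :
    ∃ K : ℝ, 0 ≤ K ∧ ∀ (n : ℤ) (m : ℕ), ‖a n m‖ ≤ K * q ^ max 0 (-(n : ℝ)) := by
  obtain ⟨k₁, k₂, k₃, A, B, h⟩ := ha
  obtain ⟨KA, hKA, hA⟩ := exists_forall_mem_le_mul (Finset.Icc (-l₁) l₁) (fun n => ‖A n‖)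
    (fun n => q ^ max 0 (-(n : ℝ))) (fun _ => norm_nonneg _)
    (fun _ => Real.rpow_pos_of_pos hq0 _)
  obtain ⟨KB, hKB, hB⟩ := exists_forall_mem_le_mul (Finset.Icc (-l₁) l₁) (fun n => ‖B n‖)
    (fun _ => 1) (fun _ => norm_nonneg _) (fun _ => one_pos)
  obtain ⟨KF, hKF, hF⟩ := exists_forall_mem_le_mul
    (Finset.Icc (-l₁) l₁ ×ˢ Finset.range (2 * l₁).toNat) (fun p => ‖a p.1 p.2‖)
    (fun p => q ^ max 0 (-(p.1 : ℝ))) (fun _ => norm_nonneg _)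
    (fun _ => Real.rpow_pos_of_pos hq0 _)
  have hk₁ := norm_nonneg k₁
  have hk₂ := norm_nonneg k₂
  have hk₃ := norm_nonneg k₃
  refine ⟨‖k₁‖ + ‖k₂‖ + ‖k₃‖ + KA + KB + KF, by positivity, fun n m => ?_⟩
  obtain ⟨h1, h2, h3, h4, h5⟩ := h n m
  have hw : 0 < q ^ max 0 (-(n : ℝ)) := Real.rpow_pos_of_pos hq0 _
  suffices H : ∃ K' : ℝ, K' ≤ ‖k₁‖ + ‖k₂‖ + ‖k₃‖ + KA + KB + KF ∧
      ‖a n m‖ ≤ K' * q ^ max 0 (-(n : ℝ)) by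
    obtain ⟨K', hK', hle⟩ := H
    exact hle.trans (by gcongr)
  rcases le_or_gt l₁ n with hn | hn
  · refine ⟨‖k₁‖, by linarith, ?_⟩
    have hn0 : (0 : ℝ) ≤ n := by exact_mod_cast hl₁.le.trans hn
    rw [h1 hn, max_eq_left (by linarith)]
    simp
  rcases lt_or_ge (-l₁) n with hn' | hn'
  · rcases le_or_gt l₁ (n + m) with hm | hm
    · refine ⟨KA, by linarith, ?_⟩
      rw [h2 hn' hn hm]
      exact hA n (Finset.mem_Icc.2 (by omega))
    · refine ⟨KF, by linarith, hF (n, m) ?_⟩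
      simp only [Finset.mem_product, Finset.mem_Icc, Finset.mem_range]
      omega
  have hn0 : (n : ℝ) ≤ 0 := by exact_mod_cast (by omega : n ≤ 0)
  rw [max_eq_right (by linarith)] at hw ⊢
  rcases le_or_gt l₁ (n + m) with hm | hm
  · refine ⟨‖k₂‖, by linarith, ?_⟩
    rw [h3 hn' hm, norm_mul, norm_qc hq0, mul_comm]
  rcases lt_or_ge (-l₁) (n + m) with hm' | hm'
  · refine ⟨KB, by linarith, ?_⟩
    rw [h4 hn' hm' hm, norm_mul, norm_qc hq0, mul_comm]
    gcongr
    simpa using hB (n + m) (Finset.mem_Icc.2 (by omega))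
  · refine ⟨‖k₃‖, by linarith, ?_⟩
    have hnm : (n : ℝ) + m ≤ 0 := by exact_mod_cast (by omega : n + (m : ℤ) ≤ 0)
    rw [h5 hm', norm_mul, norm_qc hq0, mul_comm]
    exact mul_le_mul_of_nonneg_left
      (Real.rpow_le_rpow_of_exponent_ge hq0 hq1.le (by linarith)) hk₃

lemma abs_rpow_sub_rpow_le {q : ℝ} (hq0 : 0 < q) (hq1 : q < 1) {x y z : ℝ}
    (hx : z ≤ x) (hy : z ≤ y) :
    |q ^ x - q ^ y| ≤ q ^ z * (-Real.log q * |x - y|) := by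
  wlog hxy : x ≤ y generalizing x y
  · rw [abs_sub_comm, abs_sub_comm x y]
    exact this hy hx (le_of_not_ge hxy)
  have hfac : q ^ x - q ^ y = q ^ x * (1 - q ^ (y - x)) := by
    rw [mul_sub, ← Real.rpow_add hq0]
    simp
  have hle : q ^ (y - x) ≤ 1 := Real.rpow_le_one hq0.le hq1.le (by linarith)
  have hlog : 1 - q ^ (y - x) ≤ -Real.log q * (y - x) := by
    rw [Real.rpow_def_of_pos hq0]
    linarith [Real.add_one_le_exp (Real.log q * (y - x))]
  rw [hfac, abs_of_nonneg (mul_nonneg (Real.rpow_pos_of_pos hq0 _).le (by linarith)),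
    abs_sub_comm, abs_of_nonneg (sub_nonneg.2 hxy)]
  exact mul_le_mul (Real.rpow_le_rpow_of_exponent_ge hq0 hq1.le hx) hlog (by linarith)
    (Real.rpow_pos_of_pos hq0 _).le

lemma inv_one_sub_rpow_le {q s : ℝ} (hq0 : 0 < q) (hq1 : q < 1) (hs : 0 < s) :
    (1 - q ^ s)⁻¹ ≤ 1 + (-Real.log q * s)⁻¹ := by
  have hL : 0 < -Real.log q * s := mul_pos (neg_pos.2 (Real.log_neg hq0 hq1)) hs
  have hexp := Real.add_one_le_exp (-Real.log q * s)
  have hqs : q ^ s = (Real.exp (-Real.log q * s))⁻¹ := by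
    rw [Real.rpow_def_of_pos hq0, ← Real.exp_neg]
    ring_nf
  have hle : q ^ s ≤ (-Real.log q * s + 1)⁻¹ := by
    rw [hqs]
    exact inv_anti₀ (by linarith) hexp
  have hid : 1 + (-Real.log q * s)⁻¹ = (1 - (-Real.log q * s + 1)⁻¹)⁻¹ := by
    generalize -Real.log q * s = x at hL
    have h1 : 1 - (x + 1)⁻¹ = x / (x + 1) := by
      field_simp
      ring
    rw [h1, inv_div]
    field_simp
  rw [hid]
  refine inv_anti₀ ?_ (by linarith)
  linarith [inv_lt_one_of_one_lt₀ (by linarith : 1 < -Real.log q * s + 1)]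

lemma summable_one_add_mul_rpow_half {q : ℝ} (hq0 : 0 < q) (hq1 : q < 1) :
    Summable fun j : ℕ => (1 + (j : ℝ)) * q ^ ((j : ℝ) / 2) := by
  have hr0 : 0 < q ^ (1 / 2 : ℝ) := Real.rpow_pos_of_pos hq0 _
  have hr1 : ‖q ^ (1 / 2 : ℝ)‖ < 1 := by
    rw [Real.norm_of_nonneg hr0.le]
    exact Real.rpow_lt_one hq0.le hq1 (by norm_num)
  have h := (summable_geometric_of_norm_lt_one hr1).add
    (summable_pow_mul_geometric_of_norm_lt_one 1 hr1)
  refine h.congr fun j => ?_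
  rw [← Real.rpow_mul_natCast hq0.le, pow_one, one_div_mul_eq_div]
  ring

lemma summable_one_add_abs_mul_rpow_half {q : ℝ} (hq0 : 0 < q) (hq1 : q < 1) :
    Summable fun n : ℤ => (1 + |(n : ℝ)|) * q ^ (|(n : ℝ)| / 2) :=
  Summable.of_nat_of_neg (by simpa using summable_one_add_mul_rpow_half hq0 hq1)
    (by simpa using summable_one_add_mul_rpow_half hq0 hq1)

lemma hasSum_rpow_mul_natCast {q s : ℝ} (hq0 : 0 < q) (hq1 : q < 1) (hs : 0 < s) :
    HasSum (fun m : ℕ => q ^ (s * m)) (1 - q ^ s)⁻¹ := by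
  simpa only [Real.rpow_mul_natCast hq0.le] using
    hasSum_geometric_of_lt_one (Real.rpow_pos_of_pos hq0 s).le (Real.rpow_lt_one hq0.le hq1 hs)

lemma abs_rpow_sub_rpow_abs_add_abs_le {q s : ℝ} (hq0 : 0 < q) (hq1 : q < 1) (hs : 0 < s)
    {l : ℝ} (hl : 1 ≤ l) (n : ℤ) (m j : ℕ) :
    |q ^ (s * (2 * (n : ℝ) + m + 2 * (max l (-n) + j))) - q ^ (s * (|(n : ℝ) + m| + |(n : ℝ)|))|
      ≤ q ^ (s * m) * (-Real.log q * (s * (2 * l * ((1 + |(n : ℝ)|) * (1 + j))))) := by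
  have hm : (0 : ℝ) ≤ m := m.cast_nonneg
  have hj : (0 : ℝ) ≤ j := j.cast_nonneg
  have hL : 0 < -Real.log q := neg_pos.2 (Real.log_neg hq0 hq1)
  have habs : (m : ℝ) ≤ |(n : ℝ) + m| + |(n : ℝ)| := by
    linarith [le_abs_self ((n : ℝ) + m), neg_le_abs (n : ℝ)]
  have habs' : |(n : ℝ) + m| ≤ |(n : ℝ)| + m := by
    simpa [abs_of_nonneg hm] using abs_add_le (n : ℝ) m
  have hmax : -(n : ℝ) ≤ max l (-n) := le_max_right _ _
  have hmax' : (n : ℝ) + max l (-n) ≤ |(n : ℝ)| + l := by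
    rcases max_cases l (-(n : ℝ)) with h | h <;>
      linarith [le_abs_self (n : ℝ), abs_nonneg (n : ℝ)]
  refine (abs_rpow_sub_rpow_le hq0 hq1
    (mul_le_mul_of_nonneg_left (by linarith : (m : ℝ) ≤ _) hs.le)
    (mul_le_mul_of_nonneg_left habs hs.le)).trans ?_
  rw [← mul_sub, abs_mul, abs_of_pos hs]
  have hdiff : |2 * (n : ℝ) + m + 2 * (max l (-n) + j) - (|(n : ℝ) + m| + |(n : ℝ)|)| ≤
      2 * (|(n : ℝ)| + l + j) := by
    rw [abs_le]
    constructor <;> linarith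
  have hprod : |(n : ℝ)| + l + j ≤ l * ((1 + |(n : ℝ)|) * (1 + j)) := by
    have hn := abs_nonneg (n : ℝ)
    nlinarith [mul_nonneg hn hj, mul_nonneg (sub_nonneg.2 hl) hn,
      mul_nonneg (sub_nonneg.2 hl) hj,
      mul_nonneg (zero_le_one.trans hl) (mul_nonneg hn hj)]
  gcongr
  linarith

/-- component of claim (1) with `l ≥ max(l₁, -n)`, written `l = max l₁ (-n) + j`. -/
theorem stmt6 (q : ℝ) (hq0 : 0 < q) (hq1 : q < 1) (c α : ℂ)
    (hc : ‖c‖ = 1) (hα : ‖α‖ = 1) (l₁ : ℤ) (hl₁ : 0 < l₁)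
    (d : ℕ → ℂ) (hd : IsAdmissibleSeq q c l₁ d)
    (a : ℤ → ℕ → ℂ) (ha : IsAdmissibleFam q l₁ a)
    (T : ℝ → ℤ × ℕ × ℕ → ℂ)
    (hT : ∀ (s : ℝ) (n : ℤ) (m j : ℕ),
      T s (n, m, j) = c ^ (2 * n + (m : ℤ)) * qc q ((n : ℝ) - (m : ℝ) / 2) * d m * a n m *
        (c * α) ^ (max l₁ (-n) + (j : ℤ)) *
        qc q (((max l₁ (-n) : ℤ) : ℝ) / 2 + (j : ℝ) / 2) *
        (qc q (s * (2 * (n : ℝ) + (m : ℝ) + 2 * (((max l₁ (-n) : ℤ) : ℝ) + (j : ℝ)))) -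
         qc q (s * (((|n + (m : ℤ)| : ℤ) : ℝ) + ((|n| : ℤ) : ℝ))))) :
    (∀ s : ℝ, 0 < s → Summable fun p : ℤ × ℕ × ℕ => ‖T s p‖) ∧
    Tendsto (fun s : ℝ => (s : ℂ) * ∑' p : ℤ × ℕ × ℕ, T s p)
      (𝓝[>] (0 : ℝ)) (𝓝 0) := by
  obtain ⟨D, hD, hd⟩ := hd.exists_norm_le hq0 hc
  obtain ⟨K, hK, ha⟩ := ha.exists_norm_le hq0 hq1 hl₁
  have hL : 0 < -Real.log q := neg_pos.2 (Real.log_neg hq0 hq1)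
  have hl : (1 : ℝ) ≤ l₁ := by exact_mod_cast hl₁
  set f : ℤ → ℝ := fun n => (1 + |(n : ℝ)|) * q ^ (|(n : ℝ)| / 2) with hf
  set h : ℕ → ℝ := fun j => (1 + (j : ℝ)) * q ^ ((j : ℝ) / 2) with hh
  have hfs : Summable f := summable_one_add_abs_mul_rpow_half hq0 hq1
  have hhs : Summable h := summable_one_add_mul_rpow_half hq0 hq1
  have hf0 : 0 ≤ f := fun n => by positivity
  have hh0 : 0 ≤ h := fun j => by positivity
  set C : ℝ := D * K * (2 * l₁) * -Real.log q with hC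
  have hC0 : 0 ≤ C := by positivity
  have bound : ∀ s : ℝ, 0 < s → ∀ p : ℤ × ℕ × ℕ,
      ‖T s p‖ ≤ C * s * (f p.1 * (q ^ (s * (p.2.1 : ℝ)) * h p.2.2)) := by
    rintro s hs ⟨n, m, j⟩
    have hdiff := abs_rpow_sub_rpow_abs_add_abs_le hq0 hq1 hs hl n m j
    have hexp : q ^ ((n : ℝ) - m / 2) * q ^ ((m : ℝ) / 2) * q ^ max 0 (-(n : ℝ)) *
        q ^ (max (l₁ : ℝ) (-n) / 2 + (j : ℝ) / 2) ≤ q ^ (|(n : ℝ)| / 2) * q ^ ((j : ℝ) / 2) := by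
      simp only [← Real.rpow_add hq0]
      refine Real.rpow_le_rpow_of_exponent_ge hq0 hq1.le ?_
      rcases abs_cases (n : ℝ) with h | h <;>
        linarith [le_max_left (0 : ℝ) (-n), le_max_right (0 : ℝ) (-n),
          le_max_left (l₁ : ℝ) (-n), le_max_right (l₁ : ℝ) (-n)]
    rw [hT]
    simp only [norm_mul, norm_zpow, hc, hα, norm_qc hq0, one_zpow, one_mul, mul_one]
    push_cast
    have hnorm : ∀ x y : ℝ, ‖qc q x - qc q y‖ = |q ^ x - q ^ y| := fun x y => by
      rw [qc, qc, ← Complex.ofReal_sub, Complex.norm_real, Real.norm_eq_abs]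
    rw [hnorm]
    calc _ ≤ q ^ ((n : ℝ) - m / 2) * (D * q ^ ((m : ℝ) / 2)) * (K * q ^ max 0 (-(n : ℝ))) *
          q ^ (max (l₁ : ℝ) (-n) / 2 + (j : ℝ) / 2) *
          (q ^ (s * m) * (-Real.log q * (s * (2 * l₁ * ((1 + |(n : ℝ)|) * (1 + j)))))) := by
          gcongr
          exacts [hd m, ha n m]
      _ = (q ^ ((n : ℝ) - m / 2) * q ^ ((m : ℝ) / 2) * q ^ max 0 (-(n : ℝ)) *
          q ^ (max (l₁ : ℝ) (-n) / 2 + (j : ℝ) / 2)) * (D * K *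
          (q ^ (s * m) * (-Real.log q * (s * (2 * l₁ * ((1 + |(n : ℝ)|) * (1 + j))))))) := by
          ring
      _ ≤ (q ^ (|(n : ℝ)| / 2) * q ^ ((j : ℝ) / 2)) * (D * K *
          (q ^ (s * m) * (-Real.log q * (s * (2 * l₁ * ((1 + |(n : ℝ)|) * (1 + j))))))) := by
          gcongr
      _ = _ := by
          simp only [hf, hh, hC]
          ring
  have major : ∀ s : ℝ, 0 < s → HasSum
      (fun p : ℤ × ℕ × ℕ => C * s * (f p.1 * (q ^ (s * (p.2.1 : ℝ)) * h p.2.2)))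
      (C * s * ((∑' n, f n) * ((1 - q ^ s)⁻¹ * ∑' j, h j))) := by
    intro s hs
    have hg := hasSum_rpow_mul_natCast hq0 hq1 hs
    have hg0 : 0 ≤ fun m : ℕ => q ^ (s * (m : ℝ)) := fun m => (Real.rpow_pos_of_pos hq0 _).le
    have hgh := hg.summable.mul_of_nonneg hhs hg0 hh0
    have hgh0 : 0 ≤ fun p : ℕ × ℕ => q ^ (s * (p.1 : ℝ)) * h p.2 :=
      fun p => mul_nonneg (hg0 p.1) (hh0 p.2)
    exact (hfs.hasSum.mul (hg.mul hhs.hasSum hgh)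
      (hfs.mul_of_nonneg hgh hf0 hgh0)).mul_left _
  refine ⟨fun s hs => (major s hs).summable.of_nonneg_of_le (fun _ => norm_nonneg _) (bound s hs),
    ?_⟩
  set M : ℝ := C * ((∑' n, f n) * ∑' j, h j) with hM
  have hM0 : 0 ≤ M := mul_nonneg hC0 (mul_nonneg (tsum_nonneg hf0) (tsum_nonneg hh0))
  have hlim : Tendsto (fun s : ℝ => M * (s * (s + (-Real.log q)⁻¹))) (𝓝[>] 0) (𝓝 0) := by
    have hcont : Continuous fun s : ℝ => M * (s * (s + (-Real.log q)⁻¹)) := by fun_prop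
    simpa using (hcont.tendsto 0).mono_left nhdsWithin_le_nhds
  refine squeeze_zero_norm' ?_ hlim
  filter_upwards [self_mem_nhdsWithin] with s hs
  rw [Set.mem_Ioi] at hs
  rw [norm_mul, Complex.norm_real, Real.norm_of_nonneg hs.le]
  calc s * ‖∑' p, T s p‖
      ≤ s * (C * s * ((∑' n, f n) * ((1 - q ^ s)⁻¹ * ∑' j, h j))) :=
        mul_le_mul_of_nonneg_left (tsum_of_norm_bounded (major s hs) (bound s hs)) hs.le
    _ = M * (s * (s * (1 - q ^ s)⁻¹)) := by
        rw [hM]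
        ring
    _ ≤ M * (s * (s * (1 + (-Real.log q * s)⁻¹))) := by
        gcongr
        exact inv_one_sub_rpow_le hq0 hq1 hs
    _ = M * (s * (s + (-Real.log q)⁻¹)) := by
        field_simp
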